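/- Let N, T ∈ ℕ*, ρ > 0, α ∈ ℝ, and W be an N×N random matrix with i.i.d. entries distributed as N(0, ρ²/N^{2α}). Let B_{T,N} be its generalised matrix of moments (with u = (1,...,1)^T). If l₁+l₂ is odd then B_{T,N}(l₁,l₂) = 0. If l₁ = l₂ = l and l+1 ≤ N, then ρ^{2l} N(N-1)···(N-l) / N^{2αl} ≤ B_{T,N}(l,l). -/

import Mathlib

open MeasureTheory ProbabilityTheory Matrix

/-- Weight of a walk. -/
noncomputable def walkW {N : ℕ} (A : Matrix (Fin N) (Fin N) ℝ) {l : ℕ} (p : Fin (l + 1) → Fin N) : ℝ :=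
  ∏ k : Fin l, A (p k.castSucc) (p k.succ)

/-- Number of uses of an entry. -/
def walkC {N : ℕ} {l : ℕ} (p : Fin (l + 1) → Fin N) (a : Fin N × Fin N) : ℕ :=
  (Finset.univ.filter fun k : Fin l => (p k.castSucc, p k.succ) = a).card

theorem walk_expand {N : ℕ} (A : Matrix (Fin N) (Fin N) ℝ) (l : ℕ) (i : Fin N) :
    ((A ^ l) *ᵥ (fun _ => (1 : ℝ))) i
      = ∑ p : Fin (l + 1) → Fin N, if p 0 = i then walkW A p else 0 := by
  induction l generalizing i with
  | zero =>
    rw [← (Fin.consEquiv (fun _ : Fin 1 => Fin N)).sum_comp, Fintype.sum_prod_type]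
    simp [walkW, Fin.consEquiv]
  | succ l ih =>
    rw [pow_succ', ← Matrix.mulVec_mulVec, Matrix.mulVec, dotProduct]
    simp_rw [ih]
    rw [← (Fin.consEquiv (fun _ : Fin (l + 2) => Fin N)).sum_comp, Fintype.sum_prod_type]
    rw [Finset.sum_comm]
    simp_rw [Finset.mul_sum]
    rw [Finset.sum_comm]
    refine Finset.sum_congr rfl fun p _ => ?_
    simp [Fin.consEquiv, walkW, Fin.prod_univ_succ (n := l)]

theorem walkW_eq {N : ℕ} (A : Matrix (Fin N) (Fin N) ℝ) {l : ℕ} (p : Fin (l + 1) → Fin N) :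
    walkW A p = ∏ a : Fin N × Fin N, A a.1 a.2 ^ walkC p a := by
  unfold walkW walkC
  rw [← Finset.prod_fiberwise (s := Finset.univ) (g := fun k : Fin l => (p k.castSucc, p k.succ))]
  refine Finset.prod_congr rfl fun a _ => ?_
  apply Finset.prod_eq_pow_card
  intro k hk
  rw [← (Finset.mem_filter.1 hk).2]

theorem walkC_sum {N : ℕ} {l : ℕ} (p : Fin (l + 1) → Fin N) : ∑ a, walkC p a = l := by
  unfold walkC
  rw [← Finset.card_eq_sum_card_fiberwise (by simp)]
  simp

theorem gauss_int (v : NNReal) (n : ℕ) : Integrable (fun x : ℝ => x ^ n) (gaussianReal 0 v) := by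
  have h := (memLp_id_gaussianReal (μ := 0) (v := v) (n : NNReal)).integrable_norm_pow'
  refine (integrable_norm_iff (by fun_prop)).1 ?_
  simpa using h

theorem gauss_odd (v : NNReal) (n : ℕ) (hn : Odd n) : ∫ x, x ^ n ∂(gaussianReal 0 v) = 0 := by
  have h : ∫ x, x ^ n ∂(gaussianReal 0 v) = ∫ x, (-x) ^ n ∂(gaussianReal 0 v) := by
    conv_lhs => rw [← neg_zero (G := ℝ), ← gaussianReal_map_neg]
    rw [integral_map (by fun_prop) (by fun_prop)]
  simp_rw [hn.neg_pow, integral_neg] at h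
  linarith

theorem gauss_nonneg (v : NNReal) (n : ℕ) : 0 ≤ ∫ x, x ^ n ∂(gaussianReal 0 v) := by
  rcases Nat.even_or_odd n with h | h
  · exact integral_nonneg fun x => h.pow_nonneg x
  · rw [gauss_odd v n h]

theorem gauss_two (v : NNReal) : ∫ x, x ^ 2 ∂(gaussianReal 0 v) = v := by
  have h := variance_id_gaussianReal (μ := 0) (v := v)
  rw [variance_eq_integral (by fun_prop)] at h
  simpa using h

/-- Expected product of two walk weights. -/
noncomputable def walkE {N : ℕ} (v : NNReal) {l₁ l₂ : ℕ} (p : Fin (l₁ + 1) → Fin N)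
    (q : Fin (l₂ + 1) → Fin N) : ℝ :=
  ∏ a, ∫ x, x ^ (walkC p a + walkC q a) ∂(gaussianReal 0 v)

theorem walkE_nonneg {N : ℕ} (v : NNReal) {l₁ l₂ : ℕ} (p : Fin (l₁ + 1) → Fin N)
    (q : Fin (l₂ + 1) → Fin N) : 0 ≤ walkE v p q :=
  Finset.prod_nonneg fun _ _ => gauss_nonneg _ _

theorem walkE_odd {N : ℕ} (v : NNReal) {l₁ l₂ : ℕ} (h : Odd (l₁ + l₂)) (p : Fin (l₁ + 1) → Fin N)
    (q : Fin (l₂ + 1) → Fin N) : walkE v p q = 0 := by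
  have hs : ∑ a, (walkC p a + walkC q a) = l₁ + l₂ := by
    rw [Finset.sum_add_distrib, walkC_sum, walkC_sum]
  have : ∃ a, Odd (walkC p a + walkC q a) := by
    by_contra! hc
    have : Even (∑ a, (walkC p a + walkC q a)) :=
      Finset.even_sum _ fun a _ => Nat.not_odd_iff_even.1 (hc a)
    rw [hs] at this
    exact Nat.not_odd_iff_even.2 this h
  obtain ⟨a, ha⟩ := this
  exact Finset.prod_eq_zero (Finset.mem_univ a) (gauss_odd v _ ha)

theorem walkE_inj {N : ℕ} (v : NNReal) {l : ℕ} (p : Fin (l + 1) → Fin N)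
    (hp : Function.Injective p) : walkE v p p = (v : ℝ) ^ l := by
  have hinj : Function.Injective fun k : Fin l => (p k.castSucc, p k.succ) := by
    intro a b hab
    exact Fin.castSucc_injective _ (hp (Prod.ext_iff.1 hab).1)
  have hle : ∀ a, walkC p a ≤ 1 := by
    intro a
    refine Finset.card_le_one.2 fun x hx y hy => hinj ?_
    exact (Finset.mem_filter.1 hx).2.trans (Finset.mem_filter.1 hy).2.symm
  have : ∀ a, ∫ x, x ^ (walkC p a + walkC p a) ∂(gaussianReal 0 v) = (v : ℝ) ^ walkC p a := by
    intro a
    have := hle a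
    interval_cases walkC p a
    · simp
    · simpa using gauss_two v
  unfold walkE
  simp_rw [this]
  rw [Finset.prod_pow_eq_pow_sum, walkC_sum]

theorem B_eq {Ω : Type*} [MeasurableSpace Ω] (μ : Measure Ω)
    (N : ℕ) (v : NNReal) (W : Ω → Matrix (Fin N) (Fin N) ℝ)
    (hWmeas : ∀ i j, Measurable fun ω => W ω i j)
    (hlaw : Measure.map (fun ω => fun p : Fin N × Fin N => W ω p.1 p.2) μ
      = Measure.pi fun _ => gaussianReal 0 v) (l₁ l₂ : ℕ) :
    ∫ ω, ∑ i, ((W ω ^ l₁) *ᵥ (fun _ => (1 : ℝ))) i * ((W ω ^ l₂) *ᵥ (fun _ => (1 : ℝ))) i ∂μ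
      = ∑ p : Fin (l₁ + 1) → Fin N, ∑ q : Fin (l₂ + 1) → Fin N,
          if p 0 = q 0 then walkE v p q else 0 := by
  have key : ∀ A : Matrix (Fin N) (Fin N) ℝ,
      ∑ i, ((A ^ l₁) *ᵥ (fun _ => (1 : ℝ))) i * ((A ^ l₂) *ᵥ (fun _ => (1 : ℝ))) i
      = ∑ p : Fin (l₁ + 1) → Fin N, ∑ q : Fin (l₂ + 1) → Fin N,
          if p 0 = q 0 then ∏ a : Fin N × Fin N, A a.1 a.2 ^ (walkC p a + walkC q a) else 0 := by
    intro A
    simp_rw [walk_expand, Finset.sum_mul_sum]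
    rw [Finset.sum_comm]
    refine Finset.sum_congr rfl fun p _ => ?_
    rw [Finset.sum_comm]
    refine Finset.sum_congr rfl fun q _ => ?_
    simp_rw [pow_add, Finset.prod_mul_distrib, ← walkW_eq]
    simp [eq_comm]
  simp_rw [key]
  have hm : Measurable (fun ω => fun p : Fin N × Fin N => W ω p.1 p.2) :=
    measurable_pi_lambda _ fun a => hWmeas _ _
  have hI : ∀ n : Fin N × Fin N → ℕ, Integrable (fun ω => ∏ a, W ω a.1 a.2 ^ n a) μ := by
    intro n
    have h : Integrable (fun x : Fin N × Fin N → ℝ => ∏ a, x a ^ n a)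
        (Measure.pi fun _ => gaussianReal 0 v) :=
      Integrable.fintype_prod (f := fun a x => x ^ n a) fun a => gauss_int v (n a)
    rw [← hlaw] at h
    exact h.comp_measurable hm
  have hV : ∀ n : Fin N × Fin N → ℕ, ∫ ω, ∏ a, W ω a.1 a.2 ^ n a ∂μ
      = ∏ a, ∫ x, x ^ n a ∂(gaussianReal 0 v) := by
    intro n
    rw [← integral_fintype_prod_eq_prod (fun (a : Fin N × Fin N) (x : ℝ) => x ^ n a), ← hlaw, integral_map hm.aemeasurable (Continuous.aestronglyMeasurable (by fun_prop))]
  have hI2 : ∀ (p : Fin (l₁ + 1) → Fin N) (q : Fin (l₂ + 1) → Fin N), Integrable (fun ω =>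
      if p 0 = q 0 then ∏ a : Fin N × Fin N, W ω a.1 a.2 ^ (walkC p a + walkC q a) else 0) μ := by
    intro p q
    split_ifs
    · exact hI _
    · exact integrable_zero _ _ _
  rw [integral_finsetSum _ fun p _ => integrable_finsetSum _ fun q _ => hI2 p q]
  refine Finset.sum_congr rfl fun p _ => ?_
  rw [integral_finsetSum _ fun q _ => hI2 p q]
  refine Finset.sum_congr rfl fun q _ => ?_
  split_ifs
  · exact hV _
  · simp

theorem stmt13 {Ω : Type*} [MeasurableSpace Ω] (μ : Measure Ω) [IsProbabilityMeasure μ]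
    (N : ℕ) (hN : 0 < N) (T : ℕ) (hT : 1 ≤ T) (ρ : ℝ) (hρ : 0 < ρ) (α : ℝ)
    (W : Ω → Matrix (Fin N) (Fin N) ℝ)
    (hWmeas : ∀ i j, Measurable fun ω => W ω i j)
    (hlaw : Measure.map (fun ω => fun p : Fin N × Fin N => W ω p.1 p.2) μ
      = Measure.pi fun _ => gaussianReal 0 (Real.toNNReal ((ρ / (N : ℝ) ^ α) ^ 2)))
    (u : Fin N → ℝ) (hu : u = fun _ => 1)
    (B : Matrix (Fin (T + 1)) (Fin (T + 1)) ℝ)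
    (hBdef : ∀ l₁ l₂ : Fin (T + 1),
      B l₁ l₂ = ∫ ω, ∑ i, ((W ω ^ (l₁ : ℕ)) *ᵥ u) i * ((W ω ^ (l₂ : ℕ)) *ᵥ u) i ∂μ) :
    (∀ l₁ l₂ : Fin (T + 1), Odd ((l₁ : ℕ) + (l₂ : ℕ)) → B l₁ l₂ = 0) ∧
    (∀ l : Fin (T + 1), (l : ℕ) + 1 ≤ N →
      ρ ^ (2 * (l : ℕ)) * (∏ k ∈ Finset.range ((l : ℕ) + 1), ((N : ℝ) - (k : ℝ))) /
          (N : ℝ) ^ (2 * α * (l : ℕ))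
        ≤ B l l) := by

  subst hu
  have hB : ∀ l₁ l₂ : Fin (T + 1), _ := fun l₁ l₂ =>
    (hBdef l₁ l₂).trans (B_eq μ N _ W hWmeas hlaw l₁ l₂)
  refine ⟨fun l₁ l₂ h => ?_, fun l hl => ?_⟩
  · rw [hB]
    refine Finset.sum_eq_zero fun p _ => Finset.sum_eq_zero fun q _ => ?_
    rw [walkE_odd _ h, ite_self]
  · rw [hB]
    set v := Real.toNNReal ((ρ / (N : ℝ) ^ α) ^ 2) with hv
    have hvv : (v : ℝ) = (ρ / (N : ℝ) ^ α) ^ 2 := Real.coe_toNNReal _ (sq_nonneg _)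
    have hcard : ∑ p : Fin ((l : ℕ) + 1) → Fin N,
        (if Function.Injective p then (v : ℝ) ^ (l : ℕ) else 0)
        = (∏ k ∈ Finset.range ((l : ℕ) + 1), ((N : ℝ) - (k : ℝ))) * (v : ℝ) ^ (l : ℕ) := by
      rw [← Finset.sum_filter, Finset.sum_const, nsmul_eq_mul]
      congr 1
      have h1 : (Finset.univ.filter fun p : Fin ((l : ℕ) + 1) → Fin N =>
          Function.Injective p).card = N.descFactorial ((l : ℕ) + 1) := by
        rw [← Fintype.card_subtype,
          Fintype.card_congr (Equiv.subtypeInjectiveEquivEmbedding (Fin ((l : ℕ) + 1)) (Fin N)),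
          Fintype.card_embedding_eq]
        simp
      rw [h1, Nat.descFactorial_eq_prod_range, Nat.cast_prod]
      refine Finset.prod_congr rfl fun k hk => ?_
      have := Finset.mem_range.1 hk
      rw [Nat.cast_sub (by omega)]
    have hlhs : ρ ^ (2 * (l : ℕ)) * (∏ k ∈ Finset.range ((l : ℕ) + 1), ((N : ℝ) - (k : ℝ))) /
          (N : ℝ) ^ (2 * α * (l : ℕ))
        = (∏ k ∈ Finset.range ((l : ℕ) + 1), ((N : ℝ) - (k : ℝ))) * (v : ℝ) ^ (l : ℕ) := by
      have hp : (N : ℝ) ^ (2 * α * (l : ℕ)) = ((N : ℝ) ^ α) ^ (2 * (l : ℕ)) := by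
        rw [← Real.rpow_natCast, ← Real.rpow_mul (Nat.cast_nonneg N)]
        congr 1
        push_cast
        ring
      rw [hp, hvv, ← pow_mul, div_pow]
      ring
    rw [hlhs, ← hcard]
    refine Finset.sum_le_sum fun p _ => ?_
    have hnn : ∀ q : Fin ((l : ℕ) + 1) → Fin N,
        0 ≤ (if p 0 = q 0 then walkE v p q else 0) := by
      intro q
      split_ifs
      · exact walkE_nonneg v p q
      · exact le_rfl
    refine le_trans ?_ (Finset.single_le_sum (fun q _ => hnn q) (Finset.mem_univ p))
    rw [if_pos rfl]
    split_ifs with hi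
    · exact (walkE_inj v p hi).ge
    · exact walkE_nonneg v p p
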